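/- Let f and g be functions on the torus 𝕋ⁿ. Let m ≥ 0, s₁ < n/2 and s₂ ∈ ℝ. Assume f ∈ H^{s₁} ∩ H^{m+s₁} and g ∈ H^{s₂} ∩ H^{m+s₂}. Then there exist a constant C = C(m, n, s₁, s₂) > 0 and a nonnegative sequence {c_q} ∈ ℓ² with ‖c_q‖_{ℓ²} ≤ 1 such that for every q ≥ 0, ‖∆̃_q(f g_q)‖_{L²} ≤ C c_q λ_q^{−(m+s₁+s₂−n/2)} (‖f‖_{H^{m+s₁}} ‖g‖_{H^{s₂}} + ‖f‖_{H^{s₁}} ‖g‖_{H^{m+s₂}}). -/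

import Mathlib

/-!
The paraproduct-type estimate for `f g_q` with `g_q = Δ_q g` on the torus
`𝕋ⁿ = [-L, L]ⁿ` (Lemma 2.4 of the paper), formulated on the Fourier side.
-/

open Filter Topology MeasureTheory

noncomputable section

/-- The Euclidean norm `|k|` of a frequency `k ∈ ℤⁿ` on the torus `𝕋ⁿ = [-L, L]ⁿ`. -/
def freqNorm {n : ℕ} (k : Fin n → ℤ) : ℝ := Real.sqrt (∑ i, ((k i : ℝ)) ^ 2)

/-- The `L²` norm of a function on `𝕋ⁿ`, via its Fourier coefficients. -/
def l2Norm {n : ℕ} (c : (Fin n → ℤ) → ℂ) : ℝ := (∑' k, ‖c k‖ ^ 2) ^ (1 / 2 : ℝ)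

/-- The `H^s` norm of a function on `𝕋ⁿ`, via its Fourier coefficients. -/
def hsNorm {n : ℕ} (s : ℝ) (c : (Fin n → ℤ) → ℂ) : ℝ :=
  (∑' k, ((1 : ℝ) + freqNorm k ^ 2) ^ s * ‖c k‖ ^ 2) ^ (1 / 2 : ℝ)

/-- Membership in the Sobolev space `H^s(𝕋ⁿ)`, via Fourier coefficients. -/
def memHs {n : ℕ} (s : ℝ) (c : (Fin n → ℤ) → ℂ) : Prop :=
  Summable fun k : Fin n → ℤ => ((1 : ℝ) + freqNorm k ^ 2) ^ s * ‖c k‖ ^ 2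

/-- A standard radial Littlewood–Paley cutoff profile: a smooth nonnegative
function equal to `1` for `|r| ≤ 3/4` and to `0` for `|r| ≥ 1`. -/
def IsLPCutoff (χ : ℝ → ℝ) : Prop :=
  ContDiff ℝ (⊤ : ℕ∞) χ ∧ (∀ r : ℝ, |r| ≤ 3 / 4 → χ r = 1) ∧ (∀ r : ℝ, 1 ≤ |r| → χ r = 0) ∧
    ∀ r : ℝ, 0 ≤ χ r ∧ χ r ≤ 1

/-- The dyadic frequency `λ_q = 2^q / L`. -/
def lpFreq (L : ℝ) (q : ℤ) : ℝ := 2 ^ q / L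

/-- The Fourier symbol of the Littlewood–Paley projection `Δ_q`
(`χ` itself for `q = -1`, and `φ(λ_q⁻¹ ·)` with `φ(r) = χ(r/2) - χ(r)` for `q ≥ 0`). -/
def lpSymbol (χ : ℝ → ℝ) (L : ℝ) (q : ℤ) (r : ℝ) : ℝ :=
  if q = -1 then χ r else χ (r / (2 * lpFreq L q)) - χ (r / lpFreq L q)

/-- The `q`-th Littlewood–Paley projection `Δ_q`, on the Fourier side. -/
def lpProj {n : ℕ} (χ : ℝ → ℝ) (L : ℝ) (q : ℤ) (c : (Fin n → ℤ) → ℂ) : (Fin n → ℤ) → ℂ :=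
  fun k => ((lpSymbol χ L q (freqNorm k) : ℝ) : ℂ) * c k

/-- `∆̃_q u = u_{q-1} + u_q + u_{q+1}`. -/
def lpProjT {n : ℕ} (χ : ℝ → ℝ) (L : ℝ) (q : ℤ) (c : (Fin n → ℤ) → ℂ) : (Fin n → ℤ) → ℂ :=
  fun k => lpProj χ L (q - 1) c k + lpProj χ L q c k + lpProj χ L (q + 1) c k

/-- Fourier coefficients of the product `f g` (convolution of coefficients). -/
def convF {n : ℕ} (c d : (Fin n → ℤ) → ℂ) : (Fin n → ℤ) → ℂ :=
  fun k => ∑' m, c m * d (k - m)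

/-- The commutator `[f, Δ_q] g = f Δ_q g - Δ_q (f g)`, on the Fourier side. -/
def lpComm {n : ℕ} (χ : ℝ → ℝ) (L : ℝ) (q : ℤ) (f g : (Fin n → ℤ) → ℂ) :
    (Fin n → ℤ) → ℂ :=
  fun k => convF f (lpProj χ L q g) k - lpProj χ L q (convF f g) k

lemma oneD_sum (t : ℝ) (ht0 : 0 ≤ t) (ht : t < 1/2) (N : ℕ) :
    ∑ j ∈ Finset.Icc (-(N:ℤ)) (N:ℤ), ((1:ℝ) + (j:ℝ)^2) ^ (-t) ≤
      (2 * 2 ^ t / (1 - 2*t)) * ((N:ℝ)+1) ^ (1 - 2*t) := by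
  have hd : 0 < 1 - 2*t := by linarith
  have h2t : (1:ℝ) ≤ 2 ^ t := Real.one_le_rpow (by norm_num) ht0
  have key : ∀ x : ℝ, 0 ≤ x → ((1:ℝ) + x^2) ^ (-t) ≤ 2 ^ t * (x+1) ^ (-(2*t)) := by
    intro x hx
    have h1 : (x+1)^2/2 ≤ 1 + x^2 := by nlinarith [sq_nonneg (x-1)]
    have h2 : ((1:ℝ) + x^2) ^ (-t) ≤ ((x+1)^2/2) ^ (-t) :=
      Real.rpow_le_rpow_of_nonpos (by positivity) h1 (by linarith)
    refine h2.trans (le_of_eq ?_)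
    rw [Real.div_rpow (by positivity) (by norm_num), Real.rpow_neg (by norm_num : (0:ℝ) ≤ 2),
      ← Real.rpow_natCast, ← Real.rpow_mul (by positivity)]
    rw [div_inv_eq_mul, mul_comm]
    congr 2
    push_cast; ring
  induction N with
  | zero =>
    simp
    rw [le_div_iff₀ hd]
    nlinarith
  | succ N ih =>
    have hI : Finset.Icc (-((N+1:ℕ):ℤ)) ((N+1:ℕ):ℤ) =
        insert (-((N+1:ℕ):ℤ)) (insert ((N+1:ℕ):ℤ) (Finset.Icc (-(N:ℤ)) (N:ℤ))) := by
      ext x; simp only [Finset.mem_Icc, Finset.mem_insert]; push_cast; omega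
    rw [hI, Finset.sum_insert, Finset.sum_insert]
    rotate_left
    · simp
    · simp only [Finset.mem_Icc, Finset.mem_insert]; push_cast; omega
    have e : (((-((N+1:ℕ):ℤ)):ℤ):ℝ)^2 = ((N:ℝ)+1)^2 := by push_cast; ring
    have e' : (((((N+1:ℕ):ℤ)):ℤ):ℝ)^2 = ((N:ℝ)+1)^2 := by push_cast; ring
    rw [e, e']
    have hk := key ((N:ℝ)+1) (by positivity)
    set y : ℝ := (N:ℝ)+1+1 with hy
    have hy0 : 0 < y := by positivity
    have hN : (((N+1:ℕ):ℝ)+1) = y := by push_cast; rfl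
    rw [hN]
    have hb : ((N:ℝ)+1) ^ (1-2*t) ≤ y ^ (1-2*t) - (1-2*t) * y ^ (-(2*t)) := by
      have h1 : ((N:ℝ)+1) = y * (1 + (-(1/y))) := by field_simp; rw [hy]; ring
      have hy1 : 1/y ≤ 1 := by
        rw [div_le_one hy0]; rw [hy]; linarith [(Nat.cast_nonneg N : (0:ℝ) ≤ N)]
      have h2 : (1 + (-(1/y))) ^ (1-2*t) ≤ 1 + (1-2*t) * (-(1/y)) :=
        rpow_one_add_le_one_add_mul_self (by linarith) hd.le (by linarith)
      have h3 : y ^ (-(2*t)) = y ^ (1-2*t) * (1/y) := by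
        rw [show -(2*t) = (1-2*t) - 1 by ring, Real.rpow_sub_one hy0.ne']; ring
      rw [h1, Real.mul_rpow hy0.le (by linarith), h3]
      have := mul_le_mul_of_nonneg_left h2 (Real.rpow_nonneg hy0.le (1-2*t))
      nlinarith
    have hc : 0 ≤ 2 * 2 ^ t / (1 - 2*t) := by positivity
    have := mul_le_mul_of_nonneg_left hb hc
    have e3 : 2 * 2 ^ t / (1 - 2*t) * (y ^ (1-2*t) - (1-2*t) * y ^ (-(2*t)))
        = 2 * 2 ^ t / (1 - 2*t) * y ^ (1-2*t) - 2 * (2^t * y ^ (-(2*t))) := by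
      field_simp
    linarith

def fbox (n N : ℕ) : Finset (Fin n → ℤ) :=
  Fintype.piFinset (fun _ => Finset.Icc (-(N:ℤ)) (N:ℤ))

lemma freqNorm_sq {n : ℕ} (k : Fin n → ℤ) : freqNorm k ^ 2 = ∑ i, ((k i : ℝ))^2 :=
  Real.sq_sqrt (Finset.sum_nonneg fun i _ => sq_nonneg _)

lemma box_pos (n : ℕ) (hn : 0 < n) (s : ℝ) (hs0 : 0 ≤ s) (hs : s < n / 2) :
    ∃ K > (0:ℝ), ∀ N : ℕ, ∑ k ∈ fbox n N, ((1:ℝ) + freqNorm k ^ 2) ^ (-s) ≤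
      K * ((N:ℝ)+1) ^ ((n:ℝ) - 2*s) := by
  have hn' : (0:ℝ) < n := by exact_mod_cast hn
  set t := s / n with ht
  have ht0 : 0 ≤ t := by positivity
  have ht1 : t < 1/2 := by rw [ht, div_lt_iff₀ hn']; linarith
  have hd : 0 < 1 - 2*t := by linarith
  refine ⟨(2 * 2 ^ t / (1 - 2*t))^n, by positivity, fun N => ?_⟩
  have hp : ∀ k ∈ fbox n N, ((1:ℝ) + freqNorm k ^ 2) ^ (-s) ≤
      ∏ i, ((1:ℝ) + (k i:ℝ)^2) ^ (-t) := by
    intro k _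
    have h1 : ((1:ℝ) + freqNorm k ^ 2) ^ (-s) = ∏ i : Fin n, ((1:ℝ) + freqNorm k ^ 2) ^ (-t) := by
      rw [Finset.prod_const, Finset.card_univ, Fintype.card_fin, ← Real.rpow_natCast (_ ^ (-t)),
        ← Real.rpow_mul (by positivity)]
      congr 1
      rw [ht]; field_simp
    rw [h1]
    refine Finset.prod_le_prod (fun i _ => by positivity) fun i _ => ?_
    refine Real.rpow_le_rpow_of_nonpos (by positivity) ?_ (by linarith)
    rw [freqNorm_sq]
    have := Finset.single_le_sum (f := fun i => ((k i : ℝ))^2) (fun i _ => sq_nonneg _)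
      (Finset.mem_univ i)
    linarith
  refine (Finset.sum_le_sum hp).trans ?_
  have h2 := Finset.prod_univ_sum (fun _ : Fin n => Finset.Icc (-(N:ℤ)) (N:ℤ))
    (fun _ j => ((1:ℝ) + (j:ℝ)^2) ^ (-t))
  unfold fbox
  rw [← h2, Finset.prod_const, Finset.card_univ, Fintype.card_fin]
  refine (pow_le_pow_left₀ (Finset.sum_nonneg fun j _ => by positivity)
    (oneD_sum t ht0 ht1 N) n).trans (le_of_eq ?_)
  rw [mul_pow, ← Real.rpow_natCast (((N:ℝ)+1) ^ (1 - 2*t)), ← Real.rpow_mul (by positivity)]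
  congr 2
  rw [ht]; field_simp

lemma box_sum (n : ℕ) (hn : 0 < n) (s : ℝ) (hs : s < n / 2) :
    ∃ K > (0:ℝ), ∀ N : ℕ, ∑ k ∈ fbox n N, ((1:ℝ) + freqNorm k ^ 2) ^ (-s) ≤
      K * ((N:ℝ)+1) ^ ((n:ℝ) - 2*s) := by
  rcases le_or_gt 0 s with h | h
  · exact box_pos n hn s h hs
  have hn' : (0:ℝ) < n := by exact_mod_cast hn
  obtain ⟨K, hK, hb⟩ := box_pos n hn 0 le_rfl (by positivity)
  refine ⟨((1:ℝ)+n) ^ (-s) * K, by positivity, fun N => ?_⟩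
  have hp : ∀ k ∈ fbox n N, ((1:ℝ) + freqNorm k ^ 2) ^ (-s) ≤
      (((1:ℝ)+n) ^ (-s) * ((N:ℝ)+1) ^ (-(2*s))) * ((1:ℝ) + freqNorm k ^ 2) ^ (-(0:ℝ)) := by
    intro k hk
    rw [neg_zero, Real.rpow_zero, mul_one]
    have h1 : ((N:ℝ)+1) ^ (-(2*s)) = (((N:ℝ)+1)^2) ^ (-s) := by
      rw [← Real.rpow_natCast, ← Real.rpow_mul (by positivity)]; congr 1; push_cast; ring
    rw [h1, ← Real.mul_rpow (by positivity) (by positivity)]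
    refine Real.rpow_le_rpow (by positivity) ?_ (by linarith)
    rw [freqNorm_sq]
    have h3 : ∑ i, ((k i : ℝ))^2 ≤ ∑ i : Fin n, ((N:ℝ)+1)^2 := by
      refine Finset.sum_le_sum fun i _ => ?_
      have := (Fintype.mem_piFinset.1 hk) i
      rw [Finset.mem_Icc] at this
      have h4 : (-(N:ℝ)) ≤ k i := by exact_mod_cast this.1
      have h5 : (k i : ℝ) ≤ N := by exact_mod_cast this.2
      exact sq_le_sq' (by linarith) (by linarith)
    simp at h3
    nlinarith [(Nat.cast_nonneg N : (0:ℝ) ≤ N)]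
  refine (Finset.sum_le_sum hp).trans ?_
  rw [← Finset.mul_sum]
  refine (mul_le_mul_of_nonneg_left (hb N) (by positivity)).trans (le_of_eq ?_)
  rw [show (n:ℝ) - 2*s = -(2*s) + (n - 2*0) by ring, Real.rpow_add (by positivity)]
  ring

lemma freqNorm_nonneg {n : ℕ} (k : Fin n → ℤ) : 0 ≤ freqNorm k := Real.sqrt_nonneg _

lemma freqNorm_eq {n : ℕ} (k : Fin n → ℤ) :
    freqNorm k = ‖(WithLp.toLp 2 (fun i => (k i : ℝ)) : EuclideanSpace ℝ (Fin n))‖ := by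
  rw [EuclideanSpace.norm_eq]; simp [freqNorm]

lemma freqNorm_tri {n : ℕ} (k l : Fin n → ℤ) : freqNorm l ≤ freqNorm k + freqNorm (k - l) := by
  rw [freqNorm_eq, freqNorm_eq, freqNorm_eq]
  have : (WithLp.toLp 2 (fun i => (((k - l) i : ℤ) : ℝ)) : EuclideanSpace ℝ (Fin n)) =
    WithLp.toLp 2 (fun i => (k i : ℝ)) - WithLp.toLp 2 (fun i => (l i : ℝ)) := by
    ext i; simp
  rw [this]
  set a : EuclideanSpace ℝ (Fin n) := WithLp.toLp 2 (fun i => (k i : ℝ))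
  set b : EuclideanSpace ℝ (Fin n) := WithLp.toLp 2 (fun i => (l i : ℝ))
  have := norm_sub_le a (a - b)
  simpa using this

lemma mem_fbox_of {n : ℕ} (k : Fin n → ℤ) (R : ℝ) (h : freqNorm k ≤ R) :
    k ∈ fbox n ⌊R⌋₊ := by
  have hR : 0 ≤ R := (freqNorm_nonneg k).trans h
  refine Fintype.mem_piFinset.2 fun i => ?_
  have h1 : |(k i : ℝ)| ≤ R := by
    refine le_trans ?_ h
    rw [← Real.sqrt_sq_eq_abs]
    exact Real.sqrt_le_sqrt (Finset.single_le_sum (f := fun i => ((k i : ℝ))^2)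
      (fun i _ => sq_nonneg _) (Finset.mem_univ i))
  have h2 : (k i).natAbs ≤ ⌊R⌋₊ := by
    refine Nat.le_floor ?_
    rw [Nat.cast_natAbs]; push_cast; exact h1
  rw [Finset.mem_Icc]; omega

lemma symbol_abs {χ : ℝ → ℝ} (hχ : IsLPCutoff χ) (L : ℝ) (q : ℤ) (r : ℝ) :
    |lpSymbol χ L q r| ≤ 1 := by
  obtain ⟨_, _, _, h⟩ := hχ
  unfold lpSymbol
  split_ifs
  · rw [abs_le]; constructor <;> linarith [(h r).1, (h r).2]
  · have h1 := h (r / (2 * lpFreq L q)); have h2 := h (r / lpFreq L q)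
    rw [abs_le]; constructor <;> linarith [h1.1, h1.2, h2.1, h2.2]

lemma lpFreq_pos {L : ℝ} (hL : 0 < L) (q : ℤ) : 0 < lpFreq L q := by unfold lpFreq; positivity

lemma symbol_zero_big {χ : ℝ → ℝ} (hχ : IsLPCutoff χ) {L : ℝ} (hL : 0 < L) (q : ℤ) (hq : q ≠ -1)
    (r : ℝ) (h : 2 * lpFreq L q ≤ r) : lpSymbol χ L q r = 0 := by
  have hl := lpFreq_pos hL q
  obtain ⟨_, _, h0, _⟩ := hχ
  rw [lpSymbol, if_neg hq, h0, h0, sub_zero]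
  · rw [abs_of_nonneg (by apply div_nonneg <;> linarith), le_div_iff₀ hl]; linarith
  · rw [abs_of_nonneg (by apply div_nonneg <;> linarith), le_div_iff₀ (by linarith)]; linarith

lemma symbol_zero_small {χ : ℝ → ℝ} (hχ : IsLPCutoff χ) {L : ℝ} (hL : 0 < L) (q : ℤ) (hq : q ≠ -1)
    (r : ℝ) (hr : 0 ≤ r) (h : r ≤ 3/4 * lpFreq L q) : lpSymbol χ L q r = 0 := by
  have hl := lpFreq_pos hL q
  obtain ⟨_, h0, _, _⟩ := hχ
  rw [lpSymbol, if_neg hq, h0, h0, sub_self]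
  · rw [abs_of_nonneg (by apply div_nonneg <;> linarith), div_le_iff₀ hl]; linarith
  · rw [abs_of_nonneg (by apply div_nonneg <;> linarith), div_le_iff₀ (by linarith)]; linarith

lemma projT_bound {n : ℕ} {χ : ℝ → ℝ} (hχ : IsLPCutoff χ) {L : ℝ} (hL : 0 < L) (q : ℕ)
    (u : (Fin n → ℤ) → ℂ) (k : Fin n → ℤ) : ‖lpProjT χ L q u k‖ ≤ 3 * ‖u k‖ := by
  have h : ∀ p : ℤ, ‖lpProj χ L p u k‖ ≤ ‖u k‖ := by
    intro p
    unfold lpProj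
    rw [norm_mul, Complex.norm_real, Real.norm_eq_abs]
    exact mul_le_of_le_one_left (norm_nonneg _) (symbol_abs hχ _ _ _)
  unfold lpProjT
  have := norm_add₃_le (a := lpProj χ L (q-1) u k) (b := lpProj χ L q u k) (c := lpProj χ L (q+1) u k)
  linarith [h (q-1), h q, h (q+1)]

lemma lpFreq_succ (L : ℝ) (q : ℤ) : lpFreq L (q+1) = 2 * lpFreq L q := by
  unfold lpFreq; rw [zpow_add₀ (by norm_num)]; norm_num; ring

lemma one_le_freq {L : ℝ} (hL : 0 < L) (q : ℕ) : 1 ≤ L * lpFreq L q := by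
  unfold lpFreq
  rw [mul_div_cancel₀ _ hL.ne']
  rw [zpow_natCast]; exact one_le_pow₀ (by norm_num)

lemma projT_zero {n : ℕ} {χ : ℝ → ℝ} (hχ : IsLPCutoff χ) {L : ℝ} (hL : 0 < L) (q : ℕ)
    (u : (Fin n → ℤ) → ℂ) (k : Fin n → ℤ) (hk : (4 + L) * lpFreq L q ≤ freqNorm k) :
    lpProjT χ L q u k = 0 := by
  have hl := lpFreq_pos hL q
  have h1 := one_le_freq hL q
  have hs := lpFreq_succ L q
  have hs' := lpFreq_succ L ((q:ℤ)-1)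
  rw [sub_add_cancel] at hs'
  have a1 : lpSymbol χ L q (freqNorm k) = 0 :=
    symbol_zero_big hχ hL _ (by omega) _ (by nlinarith)
  have a2 : lpSymbol χ L (q+1) (freqNorm k) = 0 :=
    symbol_zero_big hχ hL _ (by omega) _ (by rw [hs]; nlinarith)
  have a3 : lpSymbol χ L (q-1) (freqNorm k) = 0 := by
    by_cases h : (q:ℤ) - 1 = -1
    · rw [lpSymbol, if_pos h]
      apply hχ.2.2.1
      rw [abs_of_nonneg (freqNorm_nonneg k)]; nlinarith
    · exact symbol_zero_big hχ hL _ h _ (by nlinarith)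
  simp [lpProjT, lpProj, a1, a2, a3]

lemma weight_bound (L : ℝ) (hL : 0 < L) (σ : ℝ) : ∃ κ > (0:ℝ), ∀ l r : ℝ, 0 < l → 1 ≤ L * l →
    3/4 * l ≤ r → r ≤ 2 * l → 1 ≤ κ * l ^ (-(2*σ)) * (1 + r^2) ^ σ := by
  have aux : ∀ l : ℝ, 0 < l → l ^ (-(2*σ)) = ((l^2)^σ)⁻¹ := by
    intro l hl
    rw [Real.rpow_neg hl.le, ← Real.rpow_natCast, ← Real.rpow_mul hl.le]; norm_num
  rcases le_or_gt 0 σ with h | h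
  · refine ⟨2^σ, by positivity, fun l r hl h1 h2 h3 => ?_⟩
    rw [aux l hl, mul_right_comm, ← Real.mul_rpow (by norm_num) (by positivity), ← div_eq_mul_inv,
      one_le_div (by positivity)]
    exact Real.rpow_le_rpow (by positivity) (by nlinarith) h
  · refine ⟨((L^2+4)⁻¹)^σ, by positivity, fun l r hl h1 h2 h3 => ?_⟩
    rw [aux l hl, mul_right_comm, ← Real.mul_rpow (by positivity) (by positivity),
      ← div_eq_mul_inv, one_le_div (by positivity)]
    refine Real.rpow_le_rpow_of_nonpos (by positivity) ?_ h.le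
    rw [inv_mul_le_iff₀ (by positivity)]
    nlinarith

def shell (L : ℝ) (q : ℕ) (r : ℝ) : Prop := 3/4 * lpFreq L q ≤ r ∧ r ≤ 2 * lpFreq L q

open Classical in
lemma shell_count {L : ℝ} (hL : 0 < L) (r : ℝ) (F : Finset ℕ) :
    ∑ q ∈ F, (if shell L q r then (1:ℝ) else 0) ≤ 2 := by
  rw [Finset.sum_boole]
  have hc : (F.filter (fun q => shell L q r)).card ≤ 2 := by
    rcases (F.filter (fun q => shell L q r)).eq_empty_or_nonempty with h | h
    · rw [h]; simp
    · set S := F.filter (fun q => shell L q r) with hS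
      set a := S.min' h with ha
      have hsub : S ⊆ {a, a+1} := by
        intro q hq
        have h1 : a ≤ q := Finset.min'_le _ _ hq
        have h2 := (Finset.mem_filter.1 hq).2
        have h3 := (Finset.mem_filter.1 (S.min'_mem h)).2
        rw [← ha] at h3
        by_contra hne
        simp only [Finset.mem_insert, Finset.mem_singleton] at hne
        have h4 : a + 2 ≤ q := by omega
        have h5 : 4 * lpFreq L a ≤ lpFreq L q := by
          have : lpFreq L ((a+2 : ℕ):ℤ) = 4 * lpFreq L a := by
            rw [show (((a+2:ℕ)):ℤ) = (a:ℤ)+1+1 by push_cast; ring, lpFreq_succ, lpFreq_succ]; ring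
          rw [← this]
          unfold lpFreq
          have : (2:ℝ) ^ ((a+2:ℕ):ℤ) ≤ 2 ^ (q:ℤ) := zpow_le_zpow_right₀ (by norm_num) (by exact_mod_cast h4)
          gcongr
        have := lpFreq_pos hL a
        linarith [h2.1, h3.2]
      exact (Finset.card_le_card hsub).trans Finset.card_le_two
  exact_mod_cast hc

lemma proj_zero_of_not_shell {χ : ℝ → ℝ} (hχ : IsLPCutoff χ) {L : ℝ} (hL : 0 < L) (q : ℕ)
    (r : ℝ) (hr : 0 ≤ r) (h : ¬ shell L q r) : lpSymbol χ L q r = 0 := by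
  unfold shell at h
  rw [not_and_or, not_le, not_le] at h
  rcases h with h | h
  · exact symbol_zero_small hχ hL _ (by omega) _ hr h.le
  · exact symbol_zero_big hχ hL _ (by omega) _ h.le

open Classical in
theorem shell_sum {n : ℕ} {L : ℝ} (hL : 0 < L) (W : (Fin n → ℤ) → ℝ) (hW : ∀ k, 0 ≤ W k)
    (hs : Summable W) :
    ∃ c : ℕ → ℝ, (∀ q, 0 ≤ c q) ∧ (Summable fun q => c q ^ 2) ∧ (∑' q, c q ^ 2) ≤ 1 ∧
      ∀ q, ∑' k, (if shell L q (freqNorm k) then W k else 0) = 2 * c q ^ 2 * ∑' k, W k := by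
  set G := ∑' k, W k with hG
  have hG0 : 0 ≤ G := tsum_nonneg hW
  set H : ℕ → (Fin n → ℤ) → ℝ := fun q k => if shell L q (freqNorm k) then W k else 0 with hH
  have hH0 : ∀ q k, 0 ≤ H q k := by
    intro q k; simp only [hH]; split_ifs; exacts [hW k, le_rfl]
  have hHle : ∀ q k, H q k ≤ W k := by
    intro q k; simp only [hH]; split_ifs; exacts [le_rfl, hW k]
  have hHs : ∀ q, Summable (H q) := fun q => Summable.of_nonneg_of_le (hH0 q) (hHle q) hs
  have hHt : ∀ q, 0 ≤ ∑' k, H q k := fun q => tsum_nonneg (hH0 q)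
  have hF : ∀ F : Finset ℕ, ∑ q ∈ F, ∑' k, H q k ≤ 2 * G := by
    intro F
    rw [← Summable.tsum_finsetSum (fun q _ => hHs q), hG, ← tsum_mul_left]
    refine Summable.tsum_le_tsum (fun k => ?_) (summable_sum fun q _ => hHs q) (hs.mul_left 2)
    have := mul_le_mul_of_nonneg_right (shell_count hL (freqNorm k) F) (hW k)
    rw [Finset.sum_mul] at this
    refine le_trans (le_of_eq ?_) this
    refine Finset.sum_congr rfl fun q _ => ?_
    simp only [hH]; split_ifs <;> simp
  have hsq : ∀ q, Real.sqrt ((∑' k, H q k) / (2 * G)) ^ 2 = (∑' k, H q k) / (2 * G) :=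
    fun q => Real.sq_sqrt (div_nonneg (hHt q) (by linarith))
  have hb : ∀ F : Finset ℕ, ∑ q ∈ F, Real.sqrt ((∑' k, H q k) / (2 * G)) ^ 2 ≤ 1 := by
    intro F
    simp_rw [hsq]
    rw [← Finset.sum_div]
    exact div_le_one_of_le₀ (hF F) (by linarith)
  refine ⟨fun q => Real.sqrt ((∑' k, H q k) / (2 * G)), fun q => Real.sqrt_nonneg _,
    summable_of_sum_le (fun q => sq_nonneg _) hb,
    Real.tsum_le_of_sum_le (fun q => sq_nonneg _) hb, fun q => ?_⟩
  simp only [hsq]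
  rcases hG0.eq_or_lt with h | h
  · rw [← h]
    have : ∑' k, H q k ≤ G := Summable.tsum_le_tsum (hHle q) (hHs q) hs
    simp only [mul_zero]
    exact le_antisymm (this.trans h.symm.le) (hHt q)
  · field_simp
    rfl

lemma young {n : ℕ} (B : Finset (Fin n → ℤ)) (f g : (Fin n → ℤ) → ℂ)
    (hg : Summable fun k => ‖g k‖^2) :
    Summable (fun k => ‖∑ l ∈ B, f l * g (k - l)‖^2) ∧
    ∑' k, ‖∑ l ∈ B, f l * g (k - l)‖^2 ≤ (∑ l ∈ B, ‖f l‖)^2 * ∑' k, ‖g k‖^2 := by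
  have hp : ∀ k, ‖∑ l ∈ B, f l * g (k - l)‖^2 ≤
      (∑ l ∈ B, ‖f l‖) * ∑ l ∈ B, ‖f l‖ * ‖g (k-l)‖^2 := by
    intro k
    have h1 : ‖∑ l ∈ B, f l * g (k - l)‖ ≤ ∑ l ∈ B, ‖f l‖ * ‖g (k-l)‖ :=
      (norm_sum_le _ _).trans (le_of_eq (Finset.sum_congr rfl fun l _ => norm_mul _ _))
    refine (pow_le_pow_left₀ (norm_nonneg _) h1 2).trans ?_
    refine Finset.sum_sq_le_sum_mul_sum_of_sq_eq_mul B (fun l _ => norm_nonneg _)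
      (fun l _ => by positivity) (fun l _ => by ring)
  have hsh : ∀ l, HasSum (fun k => ‖g (k-l)‖^2) (∑' k, ‖g k‖^2) := fun l =>
    (Equiv.subRight l).hasSum_iff (f := fun k => ‖g k‖^2) |>.2 hg.hasSum
  have hR : HasSum (fun k => (∑ l ∈ B, ‖f l‖) * ∑ l ∈ B, ‖f l‖ * ‖g (k-l)‖^2)
      ((∑ l ∈ B, ‖f l‖) * ∑ l ∈ B, ‖f l‖ * ∑' k, ‖g k‖^2) :=
    (hasSum_sum fun l _ => (hsh l).mul_left _).mul_left _
  have hS := Summable.of_nonneg_of_le (fun k => sq_nonneg _) hp hR.summable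
  refine ⟨hS, (Summable.tsum_le_tsum hp hS hR.summable).trans (le_of_eq ?_)⟩
  rw [hR.tsum_eq, ← Finset.sum_mul]; ring

lemma f_bound {n : ℕ} (B : Finset (Fin n → ℤ)) (f : (Fin n → ℤ) → ℂ) (s : ℝ) (hf : memHs s f) :
    (∑ l ∈ B, ‖f l‖)^2 ≤ (∑ k ∈ B, ((1:ℝ) + freqNorm k ^ 2) ^ (-s)) *
      ∑' k, ((1 : ℝ) + freqNorm k ^ 2) ^ s * ‖f k‖ ^ 2 := by
  have h1 : (∑ l ∈ B, ‖f l‖)^2 ≤ (∑ k ∈ B, ((1:ℝ) + freqNorm k ^ 2) ^ (-s)) *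
      ∑ k ∈ B, ((1 : ℝ) + freqNorm k ^ 2) ^ s * ‖f k‖ ^ 2 := by
    refine Finset.sum_sq_le_sum_mul_sum_of_sq_eq_mul B (fun l _ => by positivity)
      (fun l _ => by positivity) (fun l _ => ?_)
    rw [← mul_assoc, ← Real.rpow_add (by positivity)]; simp
  refine h1.trans (mul_le_mul_of_nonneg_left ?_ (Finset.sum_nonneg fun k _ => by positivity))
  exact hf.sum_le_tsum B (fun k _ => by positivity)

/-- **Lemma 2.4.** Let `m ≥ 0`, `s₁ < n/2` and `s₂ ∈ ℝ`.  For
`f ∈ H^{s₁} ∩ H^{m+s₁}` and `g ∈ H^{s₂} ∩ H^{m+s₂}` there are a constant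
`C = C(m, n, s₁, s₂) > 0` and a sequence `{c_q} ∈ ℓ²` with `‖c_q‖_{ℓ²} ≤ 1` such
that for all `q ≥ 0`,
`‖∆̃_q(f g_q)‖_{L²} ≤ C c_q λ_q^{-(m+s₁+s₂-n/2)} (‖f‖_{H^{m+s₁}} ‖g‖_{H^{s₂}} + ‖f‖_{H^{s₁}} ‖g‖_{H^{m+s₂}})`. -/
theorem paraproduct_estimate (n : ℕ) (hn : 0 < n) (L : ℝ) (hL : 0 < L)
    (χ : ℝ → ℝ) (hχ : IsLPCutoff χ) (m s₁ s₂ : ℝ) (hm : 0 ≤ m) (hs₁ : s₁ < n / 2) :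
    ∃ C > (0 : ℝ), ∀ f g : (Fin n → ℤ) → ℂ,
      memHs s₁ f → memHs (m + s₁) f → memHs s₂ g → memHs (m + s₂) g →
      ∃ c : ℕ → ℝ, (∀ q, 0 ≤ c q) ∧ (Summable fun q => c q ^ 2) ∧
        (∑' q, c q ^ 2) ≤ 1 ∧
        ∀ q : ℕ,
          l2Norm (lpProjT χ L (q : ℤ) (convF f (lpProj χ L (q : ℤ) g))) ≤
            C * c q * lpFreq L (q : ℤ) ^ (-(m + s₁ + s₂ - n / 2)) *
              (hsNorm (m + s₁) f * hsNorm s₂ g + hsNorm s₁ f * hsNorm (m + s₂) g) := by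
  classical
  obtain ⟨K, hK, hbox⟩ := box_sum n hn s₁ hs₁
  obtain ⟨κ, hκ, hwt⟩ := weight_bound L hL (m + s₂)
  set D : ℝ := 18 * K * (6 + 2*L) ^ ((n:ℝ) - 2*s₁) * κ with hD
  have hD0 : 0 < D := by positivity
  refine ⟨Real.sqrt D, Real.sqrt_pos.2 hD0, fun f g hf _ _ hg => ?_⟩
  obtain ⟨c, hc0, hcs, hc1, hc⟩ := shell_sum hL
    (fun k : Fin n → ℤ => ((1 : ℝ) + freqNorm k ^ 2) ^ (m + s₂) * ‖g k‖ ^ 2)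
    (fun k => by positivity) hg
  refine ⟨c, hc0, hcs, hc1, fun q => ?_⟩
  set l := lpFreq L (q:ℤ) with hl
  have hl0 : 0 < l := lpFreq_pos hL q
  have hl1 : 1 ≤ L * l := one_le_freq hL q
  set gq := lpProj χ L (q:ℤ) g with hgq
  set A := ∑' k, ((1 : ℝ) + freqNorm k ^ 2) ^ s₁ * ‖f k‖ ^ 2 with hA
  set G := ∑' k, ((1 : ℝ) + freqNorm k ^ 2) ^ (m + s₂) * ‖g k‖ ^ 2 with hG
  have hA0 : 0 ≤ A := tsum_nonneg fun k => by positivity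
  have hG0 : 0 ≤ G := tsum_nonneg fun k => by positivity
  -- bound on g_q
  have hgp : ∀ k, ‖gq k‖^2 ≤ κ * l ^ (-(2*(m+s₂))) * (if shell L q (freqNorm k) then
      ((1 : ℝ) + freqNorm k ^ 2) ^ (m + s₂) * ‖g k‖ ^ 2 else 0) := by
    intro k
    split_ifs with h
    · have h1 := hwt l (freqNorm k) hl0 hl1 h.1 h.2
      have h2 : ‖gq k‖ ≤ ‖g k‖ := by
        rw [hgq]; unfold lpProj
        rw [norm_mul, Complex.norm_real, Real.norm_eq_abs]
        exact mul_le_of_le_one_left (norm_nonneg _) (symbol_abs hχ _ _ _)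
      have h3 : ‖gq k‖^2 ≤ ‖g k‖^2 := pow_le_pow_left₀ (norm_nonneg _) h2 2
      have h4 := mul_le_mul_of_nonneg_right h1 (sq_nonneg ‖g k‖)
      rw [one_mul] at h4
      rw [← mul_assoc]
      exact h3.trans h4
    · have : gq k = 0 := by
        rw [hgq]; unfold lpProj
        rw [proj_zero_of_not_shell hχ hL q _ (freqNorm_nonneg k) h]; simp
      rw [this]; simp
  have hSh : Summable (fun k : Fin n → ℤ => if shell L q (freqNorm k) then
      ((1 : ℝ) + freqNorm k ^ 2) ^ (m + s₂) * ‖g k‖ ^ 2 else 0) := by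
    refine Summable.of_nonneg_of_le (fun k => ?_) (fun k => ?_) hg
    · split_ifs <;> positivity
    · split_ifs
      · exact le_rfl
      · positivity
  have hgs : Summable (fun k => ‖gq k‖^2) :=
    Summable.of_nonneg_of_le (fun k => sq_nonneg _) hgp (hSh.mul_left _)
  have hgt : ∑' k, ‖gq k‖^2 ≤ κ * l ^ (-(2*(m+s₂))) * (2 * c q ^ 2 * G) := by
    rw [← hc q, ← tsum_mul_left]
    exact Summable.tsum_le_tsum hgp hgs (hSh.mul_left _)
  -- bound on f
  set N := ⌊(6 + L) * l⌋₊ with hN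
  have hN1 : (N:ℝ) + 1 ≤ (6 + 2*L) * l := by
    have : (N:ℝ) ≤ (6+L)*l := Nat.floor_le (by positivity)
    linarith
  have hfb : (∑ k ∈ fbox n N, ‖f k‖)^2 ≤
      K * ((6 + 2*L) ^ ((n:ℝ) - 2*s₁) * l ^ ((n:ℝ) - 2*s₁)) * A := by
    refine (f_bound (fbox n N) f s₁ hf).trans (mul_le_mul_of_nonneg_right ?_ hA0)
    refine (hbox N).trans (mul_le_mul_of_nonneg_left ?_ hK.le)
    rw [← Real.mul_rpow (by positivity) hl0.le]
    exact Real.rpow_le_rpow (by positivity) hN1 (by linarith)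
  obtain ⟨hYs, hY⟩ := young (fbox n N) f gq hgs
  have hpt : ∀ k, ‖lpProjT χ L (q:ℤ) (convF f gq) k‖^2 ≤
      9 * ‖∑ j ∈ fbox n N, f j * gq (k - j)‖^2 := by
    intro k
    rcases le_or_gt ((4+L)*l) (freqNorm k) with h | h
    · rw [projT_zero hχ hL q _ k h]; simp
    · have hconv : convF f gq k = ∑ j ∈ fbox n N, f j * gq (k - j) := by
        unfold convF
        refine tsum_eq_sum fun j hj => ?_
        have h1 : (6+L)*l < freqNorm j := by
          by_contra h'
          exact hj (mem_fbox_of j _ (not_lt.1 h'))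
        have h2 := freqNorm_tri k j
        have h3 : gq (k - j) = 0 := by
          rw [hgq]; unfold lpProj
          rw [symbol_zero_big hχ hL _ (by omega) _ (by rw [← hl]; linarith)]; simp
        rw [h3, mul_zero]
      have := projT_bound hχ hL q (convF f gq) k
      rw [hconv] at this
      have h2 := pow_le_pow_left₀ (norm_nonneg _) this 2
      rw [mul_pow] at h2
      norm_num at h2
      exact h2
  have hTs : Summable (fun k => ‖lpProjT χ L (q:ℤ) (convF f gq) k‖^2) :=
    Summable.of_nonneg_of_le (fun k => sq_nonneg _) hpt (hYs.mul_left _)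
  have hT : ∑' k, ‖lpProjT χ L (q:ℤ) (convF f gq) k‖^2 ≤
      D * c q ^ 2 * (l ^ ((n:ℝ) - 2*s₁) * l ^ (-(2*(m+s₂)))) * (A * G) := by
    calc _ ≤ ∑' k, 9 * ‖∑ j ∈ fbox n N, f j * gq (k - j)‖^2 :=
          Summable.tsum_le_tsum hpt hTs (hYs.mul_left _)
      _ = 9 * ∑' k, ‖∑ j ∈ fbox n N, f j * gq (k - j)‖^2 := tsum_mul_left
      _ ≤ 9 * ((K * ((6 + 2*L) ^ ((n:ℝ) - 2*s₁) * l ^ ((n:ℝ) - 2*s₁)) * A) *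
            (κ * l ^ (-(2*(m+s₂))) * (2 * c q ^ 2 * G))) := by
          refine mul_le_mul_of_nonneg_left (hY.trans ?_) (by norm_num)
          exact mul_le_mul hfb hgt (tsum_nonneg fun k => sq_nonneg _) (by positivity)
      _ = _ := by rw [hD]; ring
  have hexp : l ^ ((n:ℝ) - 2*s₁) * l ^ (-(2*(m+s₂))) = (l ^ (-(m + s₁ + s₂ - n / 2)))^2 := by
    rw [← Real.rpow_natCast, ← Real.rpow_mul hl0.le, ← Real.rpow_add hl0]
    congr 1; push_cast; ring
  rw [hexp] at hT
  have hmain : l2Norm (lpProjT χ L (q : ℤ) (convF f gq)) ≤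
      Real.sqrt D * c q * l ^ (-(m + s₁ + s₂ - n / 2)) * (hsNorm s₁ f * hsNorm (m + s₂) g) := by
    unfold l2Norm hsNorm
    rw [← hA, ← hG, ← Real.sqrt_eq_rpow, ← Real.sqrt_eq_rpow, ← Real.sqrt_eq_rpow]
    have hcq := hc0 q
    refine Real.sqrt_le_iff.2 ⟨by positivity, hT.trans (le_of_eq ?_)⟩
    rw [mul_pow, mul_pow, mul_pow, mul_pow, Real.sq_sqrt hD0.le, Real.sq_sqrt hA0, Real.sq_sqrt hG0]
  refine hmain.trans (mul_le_mul_of_nonneg_left ?_ ?_)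
  · have h1 : 0 ≤ hsNorm (m + s₁) f := Real.rpow_nonneg (tsum_nonneg fun k => by positivity) _
    have h2 : 0 ≤ hsNorm s₂ g := Real.rpow_nonneg (tsum_nonneg fun k => by positivity) _
    nlinarith [mul_nonneg h1 h2]
  · have hcq := hc0 q
    positivity
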